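/- Pointwise Jacobian bound for the Gauss map: if γ₁, γ₂ : ℝ → ℝ⁴ are differentiable at s and t respectively and γ₁(s) ≠ γ₂(t), then for G(s,t) = (γ₁(s) − γ₂(t))/‖γ₁(s) − γ₂(t)‖ one has √( ‖∂ₛG(s,t)‖² ‖∂ₜG(s,t)‖² − ⟨∂ₛG(s,t), ∂ₜG(s,t)⟩² ) ≤ ‖γ₁′(s)‖ ‖γ₂′(t)‖ / ‖γ₁(s) − γ₂(t)‖². -/

import Mathlib

open Real RealInnerProductSpace

noncomputable section

/-- The Gauss map of a pair of disjoint curves in `ℝ⁴`, with values in `S³`. -/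
def gaussMap (γ₁ γ₂ : ℝ → EuclideanSpace ℝ (Fin 4)) (s t : ℝ) : EuclideanSpace ℝ (Fin 4) :=
  ‖γ₁ s - γ₂ t‖⁻¹ • (γ₁ s - γ₂ t)

/-- The derivative of the normalization of a curve that does not vanish at `x`. -/
theorem hasDerivAt_inv_norm_smul {E : Type*} [NormedAddCommGroup E] [InnerProductSpace ℝ E]
    {f : ℝ → E} {f' : E} {x : ℝ} (hf : HasDerivAt f f' x) (h0 : f x ≠ 0) :
    HasDerivAt (fun y => ‖f y‖⁻¹ • f y)
      (‖f x‖⁻¹ • f' - (⟪f x, f'⟫ / ‖f x‖ ^ 3) • f x) x := by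
  have hr : ‖f x‖ ≠ 0 := norm_ne_zero_iff.mpr h0
  have hnorm : HasDerivAt (fun y => ‖f y‖) (⟪f x, f'⟫ / ‖f x‖) x := by
    have h := hf.norm_sq.sqrt (pow_ne_zero 2 hr)
    simp only [Real.sqrt_sq (norm_nonneg _)] at h
    rwa [mul_div_mul_left _ _ two_ne_zero] at h
  refine ((hnorm.fun_inv hr).fun_smul hf).congr_deriv ?_
  rw [sub_eq_add_neg, ← neg_smul]
  congr 2
  field_simp

/-- Normalizing a curve scales its speed by at most the inverse of its norm. -/
theorem norm_deriv_inv_norm_smul_le {E : Type*} [NormedAddCommGroup E] [InnerProductSpace ℝ E]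
    {f : ℝ → E} {f' : E} {x : ℝ} (hf : HasDerivAt f f' x) (h0 : f x ≠ 0) :
    ‖deriv (fun y => ‖f y‖⁻¹ • f y) x‖ ≤ ‖f'‖ / ‖f x‖ := by
  rw [(hasDerivAt_inv_norm_smul hf h0).deriv]
  have hr : ‖f x‖ ≠ 0 := norm_ne_zero_iff.mpr h0
  refine (sq_le_sq₀ (norm_nonneg _) (by positivity)).mp ?_
  have key : ‖‖f x‖⁻¹ • f' - (⟪f x, f'⟫ / ‖f x‖ ^ 3) • f x‖ ^ 2 =
      (‖f'‖ / ‖f x‖) ^ 2 - (⟪f x, f'⟫ / ‖f x‖ ^ 2) ^ 2 := by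
    rw [norm_sub_sq_real, norm_smul, norm_smul, real_inner_smul_left, real_inner_smul_right,
      real_inner_comm, mul_pow, mul_pow, Real.norm_eq_abs, Real.norm_eq_abs, sq_abs, sq_abs]
    field_simp
    ring
  rw [key]
  exact sub_le_self _ (sq_nonneg _)

/-- Pointwise bound on the `2`-dimensional Jacobian of the Gauss map of a pair of curves
in `ℝ⁴` by the integrand of the Möbius cross energy. -/
theorem gaussMap_jacobian_pointwise_bound (γ₁ γ₂ : ℝ → EuclideanSpace ℝ (Fin 4)) (s t : ℝ)
    (h₁ : DifferentiableAt ℝ γ₁ s) (h₂ : DifferentiableAt ℝ γ₂ t)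
    (hst : γ₁ s ≠ γ₂ t) :
    Real.sqrt (‖deriv (fun s' => gaussMap γ₁ γ₂ s' t) s‖ ^ 2 *
        ‖deriv (fun t' => gaussMap γ₁ γ₂ s t') t‖ ^ 2 -
      ⟪deriv (fun s' => gaussMap γ₁ γ₂ s' t) s,
        deriv (fun t' => gaussMap γ₁ γ₂ s t') t⟫ ^ 2) ≤
      ‖deriv γ₁ s‖ * ‖deriv γ₂ t‖ / ‖γ₁ s - γ₂ t‖ ^ 2 := by
  have hne : γ₁ s - γ₂ t ≠ 0 := sub_ne_zero.mpr hst
  have hs : ‖deriv (fun s' => gaussMap γ₁ γ₂ s' t) s‖ ≤ ‖deriv γ₁ s‖ / ‖γ₁ s - γ₂ t‖ :=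
    norm_deriv_inv_norm_smul_le (h₁.hasDerivAt.sub_const (γ₂ t)) hne
  have ht : ‖deriv (fun t' => gaussMap γ₁ γ₂ s t') t‖ ≤ ‖deriv γ₂ t‖ / ‖γ₁ s - γ₂ t‖ := by
    rw [← norm_neg (deriv γ₂ t)]
    exact norm_deriv_inv_norm_smul_le (h₂.hasDerivAt.const_sub (γ₁ s)) hne
  calc
    _ ≤ √((‖deriv (fun s' => gaussMap γ₁ γ₂ s' t) s‖ *
          ‖deriv (fun t' => gaussMap γ₁ γ₂ s t') t‖) ^ 2) := by
      rw [mul_pow]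
      exact Real.sqrt_le_sqrt (sub_le_self _ (sq_nonneg _))
    _ = ‖deriv (fun s' => gaussMap γ₁ γ₂ s' t) s‖ *
          ‖deriv (fun t' => gaussMap γ₁ γ₂ s t') t‖ := Real.sqrt_sq (by positivity)
    _ ≤ ‖deriv γ₁ s‖ / ‖γ₁ s - γ₂ t‖ * (‖deriv γ₂ t‖ / ‖γ₁ s - γ₂ t‖) := by gcongr
    _ = _ := by rw [div_mul_div_comm, sq]

end
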